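/- Let w be any permutation. For every reduced compatible sequence (r ; a) ∈ PD(w), there exist a Grassmannian permutation v and a finite sequence of Little bumps L_{i_1 j_1}, ..., L_{i_k j_k} such that L_{i_k j_k} ∘ ⋯ ∘ L_{i_1 j_1}(r ; a) ∈ PD(v). -/

import Mathlib

/- Common definitions for formalizing "Lenart's bijection via bumpless pipe dreams"
   (Gregory–Hamaker). -/

namespace BPDPaper

/-! ### Permutations of the positive integers -/

/-- We model permutations of the positive integers as permutations of `ℕ`
(fixing `0`, with finite support). -/
abbrev Perm' := Equiv.Perm ℕ

/-- The simple transposition `s_a = t_{a,a+1}`. -/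
def sT (a : ℕ) : Perm' := Equiv.swap a (a + 1)

/-- The transposition `t_{ij}`. -/
def tT (i j : ℕ) : Perm' := Equiv.swap i j

/-- The product `s_{a_1} ⋯ s_{a_p}` of a word. -/
def wordProd (l : List ℕ) : Perm' := (l.map sT).prod

/-- `l` is a word for `w` (in the letters `s_1, s_2, …`). -/
def IsWord (w : Perm') (l : List ℕ) : Prop := (∀ x ∈ l, 1 ≤ x) ∧ wordProd l = w

/-- The Coxeter length `ℓ(w)`: the minimal length of a word for `w`. -/
noncomputable def plen (w : Perm') : ℕ :=
  sInf {m | ∃ l : List ℕ, IsWord w l ∧ l.length = m}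

/-- `l` is a reduced word for `w`. -/
def IsReducedWord (w : Perm') (l : List ℕ) : Prop := IsWord w l ∧ l.length = plen w

/-- A permutation of the positive integers: fixes `0` and all but finitely many points. -/
def IsPerm (w : Perm') : Prop := w 0 = 0 ∧ {k | w k ≠ k}.Finite

/-- `k` is a descent of `w`. -/
def Descent (w : Perm') (k : ℕ) : Prop := 1 ≤ k ∧ w (k + 1) < w k

/-- `w` is Grassmannian: at most one descent. -/
def Grassmannian (w : Perm') : Prop := IsPerm w ∧ Set.Subsingleton {k | Descent w k}

/-- `w` is vexillary: no indices `i < j < k < l` with `w j < w i < w l < w k`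
(pattern 2143 avoidance). -/
def Vexillary (w : Perm') : Prop := IsPerm w ∧
  ¬ ∃ i j k l : ℕ, 1 ≤ i ∧ i < j ∧ j < k ∧ k < l ∧ w j < w i ∧ w i < w l ∧ w l < w k

/-- The code `c_i(w) = #{j > i : w j < w i}`. -/
noncomputable def codeOf (w : Perm') (i : ℕ) : ℕ := Nat.card {j : ℕ | i < j ∧ w j < w i}

/-- Insert into a weakly decreasing list, keeping it weakly decreasing. -/
def insDesc (x : ℕ) : List ℕ → List ℕ
  | [] => [x]
  | y :: ys => if y < x then x :: y :: ys else y :: insDesc x ys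

/-- Sort a list into weakly decreasing order. -/
def sortDesc (l : List ℕ) : List ℕ := l.foldr insDesc []

/-- The shape `λ(w)`: the code `(c_1(w), …, c_n(w))` sorted decreasingly, zeros dropped
(`n` is any bound on the support of `w`). -/
noncomputable def shapeOf (w : Perm') (n : ℕ) : List ℕ :=
  (sortDesc ((List.range' 1 n).map (codeOf w))).filter (fun x => decide (0 < x))

/-- The Rothe diagram `D_w = {(i, w j) : i < j, w j < w i}` (matrix coordinates). -/
def RotheDiagram (w : Perm') : Set (ℕ × ℕ) :=
  {p | 1 ≤ p.1 ∧ ∃ j, p.1 < j ∧ w j < w p.1 ∧ p.2 = w j}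

/-- `φ_i`: the row index of the southeast-most box of `D_w` on the diagonal through
`(i, λ_i)`. -/
noncomputable def flagEntry (w : Perm') (i li : ℕ) : ℕ :=
  sSup {r : ℕ | ∃ c : ℕ, (r, c) ∈ RotheDiagram w ∧ (c : ℤ) - (r : ℤ) = (li : ℤ) - (i : ℤ)}

/-- The flag `φ(w) = (φ_1, …, φ_m)` of a vexillary permutation. -/
noncomputable def flagOf (w : Perm') (n : ℕ) : List ℕ :=
  (List.range (shapeOf w n).length).map (fun k => flagEntry w (k + 1) ((shapeOf w n).getD k 0))

/-- `ρ(w)_i`: the `i`-th row of the smallest partition whose Young diagram contains `D_w`. -/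
noncomputable def rhoRow (w : Perm') (i : ℕ) : ℕ :=
  sSup {c : ℕ | ∃ r : ℕ, i ≤ r ∧ (r, c) ∈ RotheDiagram w}

/-! ### Tableaux (lists of rows), flagged SSYT, jeu de taquin -/

/-- Semistandard Young tableau of partition shape, presented as a list of rows. -/
def IsSSYT (T : List (List ℕ)) : Prop :=
  (∀ row ∈ T, row ≠ []) ∧
  List.Chain' (fun r1 r2 : List ℕ => r2.length ≤ r1.length) T ∧
  (∀ row ∈ T, List.Chain' (· ≤ ·) row) ∧
  (∀ i j : ℕ, i + 1 < T.length → j < (T.getD (i + 1) []).length →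
    (T.getD i []).getD j 0 < (T.getD (i + 1) []).getD j 0)

/-- `φ`-flagged semistandard Young tableaux of shape `λ`: the last entry of row `i`
is at most `φ_i`. -/
def IsFlaggedSSYT (lam phi : List ℕ) (T : List (List ℕ)) : Prop :=
  IsSSYT T ∧ T.map List.length = lam ∧
  ∀ i : ℕ, i < T.length → (T.getD i []).getLastD 0 ≤ phi.getD i 0

/-- Semistandard Young tableaux with all entries at most `k` (`SSYT_k`). -/
def IsSSYTBounded (k : ℕ) (T : List (List ℕ)) : Prop :=
  IsSSYT T ∧ ∀ row ∈ T, ∀ x ∈ row, x ≤ k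

/-- Set an entry of a tableau. -/
def setEntry (T : List (List ℕ)) (r c x : ℕ) : List (List ℕ) :=
  T.set r ((T.getD r []).set c x)

/-- One jeu de taquin slide with the empty tile at `(r, c)` (0-indexed):
swap the empty tile with the smaller of the entries to its right and below
(ties move down; missing boxes are `∞`); when both are missing, delete the cell. -/
def jdtAux : ℕ → List (List ℕ) → ℕ → ℕ → List (List ℕ)
  | 0, T, _, _ => T
  | fuel + 1, T, r, c =>
    match (T.getD r [])[c + 1]?, (T.getD (r + 1) [])[c]? with
    | none, none => (T.set r ((T.getD r []).take c)).filter (fun row => !row.isEmpty)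
    | some x, none => jdtAux fuel (setEntry T r c x) r (c + 1)
    | none, some y => jdtAux fuel (setEntry T r c y) (r + 1) c
    | some x, some y =>
      if x < y then jdtAux fuel (setEntry T r c x) r (c + 1)
      else jdtAux fuel (setEntry T r c y) (r + 1) c

/-- `jdt(T)`: remove the top-left box of `T` and rectify by jeu de taquin. -/
def jdt (T : List (List ℕ)) : List (List ℕ) :=
  jdtAux ((T.map List.length).sum + 1) T 0 0

/-! ### Edelman–Greene column insertion and the recording tableau -/

/-- Edelman–Greene insertion of `x` into one increasing column `C`.
Returns the new column together with `none` (if `x` was appended, creating a new box)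
or `some y` (where `y` is to be inserted into the next column). -/
def colIns (x : ℕ) (C : List ℕ) : List ℕ × Option ℕ :=
  if C.all (fun c => decide (c < x)) then (C ++ [x], none)
  else if x ∈ C ∧ (x + 1) ∈ C then (C, some (x + 1))
  else
    match C.find? (fun c => decide (x < c)) with
    | some ck => (C.map (fun c => if c = ck then x else c), some ck)
    | none => (C, none)

/-- Edelman–Greene insertion of `x` into a tableau presented as a list of columns.
Returns the new columns and the (0-indexed) column containing the new box. -/
def egInsert : List (List ℕ) → ℕ → (List (List ℕ)) × ℕ
  | [], x => ([[x]], 0)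
  | C :: rest, x =>
    match colIns x C with
    | (C', none) => (C' :: rest, 0)
    | (C', some y) =>
      let res := egInsert rest y
      (C' :: res.1, res.2 + 1)

/-- One step of the Edelman–Greene algorithm on the pair (insertion, recording) tableau:
insert `ra.2` into `P` and record `ra.1` in the new box of `Q`. -/
def egStep (PQ : (List (List ℕ)) × (List (List ℕ))) (ra : ℕ × ℕ) :
    (List (List ℕ)) × (List (List ℕ)) :=
  let res := egInsert PQ.1 ra.2
  let Q := PQ.2
  let Q' := if res.2 < Q.length then Q.set res.2 (Q.getD res.2 [] ++ [ra.1]) else Q ++ [[ra.1]]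
  (res.1, Q')

/-- A biword `(r_1,…,r_l ; a_1,…,a_l)`. -/
structure Biword where
  top : List ℕ
  bot : List ℕ

/-- The (insertion, recording) column tableaux of a biword under Edelman–Greene insertion. -/
def egPQ (P : Biword) : (List (List ℕ)) × (List (List ℕ)) :=
  (P.top.zip P.bot).foldl egStep ([], [])

/-- Convert a tableau presented as a list of columns into a list of rows. -/
def colsToRows (cols : List (List ℕ)) : List (List ℕ) :=
  (List.range ((cols.map List.length).foldr max 0)).map
    (fun i => cols.filterMap (fun col => col[i]?))

/-- The Edelman–Greene recording tableau `Q̃` of a biword (as a list of rows). -/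
def Qtilde (P : Biword) : List (List ℕ) := colsToRows (egPQ P).2

/-- The Edelman–Greene insertion tableau `P̃` of a biword (as a list of rows). -/
def Ptilde (P : Biword) : List (List ℕ) := colsToRows (egPQ P).1

/-- `(r ; a)` is a reduced compatible sequence for `w`: `a` is a reduced word for `w`,
`r` is weakly increasing, `r_i ≤ a_i`, and `r_i < r_{i+1}` whenever `a_i < a_{i+1}`.
Membership in `PD(w)`. -/
def IsCompatible (w : Perm') (P : Biword) : Prop :=
  IsReducedWord w P.bot ∧
  List.Chain' (· ≤ ·) P.top ∧
  List.Forall₂ (· ≤ ·) P.top P.bot ∧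
  (∀ m : ℕ, m + 1 < P.bot.length →
    P.bot.getD m 0 < P.bot.getD (m + 1) 0 → P.top.getD m 0 < P.top.getD (m + 1) 0)

/-! ### Bumpless pipe dreams -/

/-- The tiles: blank, vertical, horizontal, ⌐-elbow (S–E, "r"), ⌟-elbow (W–N, "j"),
crossing, and the bump tile (for almost bumpless pipe dreams). -/
inductive Tile
  | blank | vert | horiz | se | nw | cross | bump
deriving DecidableEq

/-- A square grid of tiles; rows and columns are 1-indexed, rows increase downward. -/
structure Grid where
  n : ℕ
  tile : ℕ → ℕ → Tile

inductive Dir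
  | north | east
deriving DecidableEq

def hasN : Tile → Bool
  | .vert => true | .nw => true | .cross => true | .bump => true | _ => false
def hasS : Tile → Bool
  | .vert => true | .se => true | .cross => true | .bump => true | _ => false
def hasE : Tile → Bool
  | .horiz => true | .se => true | .cross => true | .bump => true | _ => false
def hasW : Tile → Bool
  | .horiz => true | .nw => true | .cross => true | .bump => true | _ => false

/-- The outgoing direction of a pipe through a tile, given the incoming heading
(`north` = entered through the south edge, `east` = entered through the west edge). -/
def outDir : Tile → Dir → Option Dir
  | .vert, .north => some .north
  | .cross, .north => some .north
  | .se, .north => some .east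
  | .bump, .north => some .east
  | .horiz, .east => some .east
  | .cross, .east => some .east
  | .nw, .east => some .north
  | .bump, .east => some .north
  | _, _ => none

/-- Trace a pipe; returns the row in which it exits through the east edge of the grid. -/
def traceAux (g : Grid) : ℕ → ℕ → ℕ → Dir → Option ℕ
  | 0, _, _, _ => none
  | fuel + 1, x, y, d =>
    match outDir (g.tile x y) d with
    | none => none
    | some Dir.north => if x ≤ 1 then none else traceAux g fuel (x - 1) y Dir.north
    | some Dir.east => if g.n ≤ y then some x else traceAux g fuel x (y + 1) Dir.east

/-- The exit row of the pipe entering at the bottom of column `c`. -/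
def exitRow (g : Grid) (c : ℕ) : Option ℕ := traceAux g (2 * g.n + 2) g.n c Dir.north

/-- The list of states `(row, column, heading)` visited by a pipe. -/
def pathAux (g : Grid) : ℕ → ℕ → ℕ → Dir → List (ℕ × ℕ × Dir)
  | 0, _, _, _ => []
  | fuel + 1, x, y, d =>
    (x, y, d) ::
      (match outDir (g.tile x y) d with
       | none => []
       | some Dir.north => if x ≤ 1 then [] else pathAux g fuel (x - 1) y Dir.north
       | some Dir.east => if g.n ≤ y then [] else pathAux g fuel x (y + 1) Dir.east)

/-- The path of the pipe entering at the bottom of column `c`. -/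
def pipePath (g : Grid) (c : ℕ) : List (ℕ × ℕ × Dir) := pathAux g (2 * g.n + 2) g.n c Dir.north

/-- Pipe `c` passes through position `z`. -/
def passes (g : Grid) (c : ℕ) (z : ℕ × ℕ) : Prop :=
  ∃ d : Dir, (z.1, z.2, d) ∈ pipePath g c

def InGrid (g : Grid) (i j : ℕ) : Prop := 1 ≤ i ∧ i ≤ g.n ∧ 1 ≤ j ∧ j ≤ g.n

/-- A (reduced) bumpless pipe dream: tiles match along edges; pipes enter along the
bottom and exit along the right; no bump tiles; no two pipes cross more than once.
(Tiles outside the grid are normalized to `horiz`.) -/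
def IsBPD (g : Grid) : Prop :=
  1 ≤ g.n ∧
  (∀ i j, ¬ InGrid g i j → g.tile i j = Tile.horiz) ∧
  (∀ i j, InGrid g i j → g.tile i j ≠ Tile.bump) ∧
  (∀ i j, 1 ≤ i → i < g.n → 1 ≤ j → j ≤ g.n → hasS (g.tile i j) = hasN (g.tile (i + 1) j)) ∧
  (∀ i j, 1 ≤ i → i ≤ g.n → 1 ≤ j → j < g.n → hasE (g.tile i j) = hasW (g.tile i (j + 1))) ∧
  (∀ j, 1 ≤ j → j ≤ g.n → hasN (g.tile 1 j) = false) ∧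
  (∀ j, 1 ≤ j → j ≤ g.n → hasS (g.tile g.n j) = true) ∧
  (∀ i, 1 ≤ i → i ≤ g.n → hasW (g.tile i 1) = false) ∧
  (∀ i, 1 ≤ i → i ≤ g.n → hasE (g.tile i g.n) = true) ∧
  (∀ c c', 1 ≤ c → c ≤ g.n → 1 ≤ c' → c' ≤ g.n → c ≠ c' →
    Set.Subsingleton {z : ℕ × ℕ | g.tile z.1 z.2 = Tile.cross ∧ passes g c z ∧ passes g c' z})

/-- `g ∈ BPD(w)`: `g` is a bumpless pipe dream whose permutation is `w`, i.e. the pipe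
entering at the bottom of column `c` exits to the right in row `w⁻¹(c)`. -/
def MemBPD (w : Perm') (g : Grid) : Prop :=
  IsBPD g ∧ w 0 = 0 ∧ (∀ k, g.n < k → w k = k) ∧
  (∀ c, 1 ≤ c → c ≤ g.n → exitRow g c = some (w.symm c))

/-! ### Weigandt's map γ -/

/-- The blank tiles on the diagonal `{(i,j) : j - i = d}`, from northwest to southeast. -/
def blanksOnDiag (g : Grid) (d : ℤ) : List (ℕ × ℕ) :=
  (List.range' 1 g.n).filterMap (fun (i : ℕ) =>
    let jz : ℤ := (i : ℤ) + d
    if 1 ≤ jz ∧ jz ≤ (g.n : ℤ) then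
      (if g.tile i jz.toNat = Tile.blank then some (i, jz.toNat) else none)
    else none)

/-- The number of pipes passing above position `(i,j)`: tiles above it in column `j`
in which a pipe travels eastward. -/
def pipesAbove (g : Grid) (i j : ℕ) : ℕ :=
  ((List.range' 1 g.n).filter (fun x => decide (x < i) && hasE (g.tile x j))).length

/-- Weigandt's map `γ` (for vexillary permutations): fill each blank tile with the number
of pipes above it, slide the filled tiles northwest along their diagonals into the Young
diagram of `lam`, and add `i` to every entry in row `i`. -/
def weigandt (g : Grid) (lam : List ℕ) : List (List ℕ) :=
  (List.range lam.length).map (fun (r0 : ℕ) =>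
    (List.range (lam.getD r0 0)).map (fun (c0 : ℕ) =>
      let r : ℕ := r0 + 1
      let c : ℕ := c0 + 1
      let p := (blanksOnDiag g ((c : ℤ) - (r : ℤ))).getD (min r c - 1) (0, 0)
      pipesAbove g p.1 p.2 + r))

/-! ### The Gao–Huang operator ∇, pop, and the bijection φ -/

/-- Backward tracing: enter tile `(x,y)` through its north edge (`viaN = true`) or its
east edge (`viaN = false`) and follow the pipe backwards; returns the bottom column
at which the pipe enters the grid. -/
def backAux (g : Grid) : ℕ → ℕ → ℕ → Bool → Option ℕ
  | 0, _, _, _ => none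
  | fuel + 1, x, y, viaN =>
    if g.n < x then none
    else if viaN then
      match g.tile x y with
      | .vert | .cross => if x = g.n then some y else backAux g fuel (x + 1) y true
      | .nw | .bump => backAux g fuel x (y - 1) false
      | _ => none
    else
      match g.tile x y with
      | .horiz | .cross => backAux g fuel x (y - 1) false
      | .se | .bump => if x = g.n then some y else backAux g fuel (x + 1) y true
      | _ => none

/-- The label of the pipe passing through `(x,y)` entering from the south. -/
def pipeFromS (g : Grid) (x y : ℕ) : Option ℕ :=
  if x = g.n then some y else backAux g (2 * g.n + 2) (x + 1) y true

/-- Move the mark east to the rightmost blank tile in its contiguous block of blanks. -/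
def slideEast (g : Grid) (i j : ℕ) : ℕ :=
  ((List.range' j (g.n + 1)).takeWhile (fun y => g.tile i y == Tile.blank)).getLastD j

/-- Tile rewrite for the undroop of the pipe `p` (from `(i', j+1)` into `(i, j)`)
performed in one iteration of the Gao–Huang procedure; the `(i', j+1)` case `cross → se`
is the final uncrossing step. -/
def nablaUndroop (T : ℕ → ℕ → Tile) (i i' j : ℕ) : ℕ → ℕ → Tile := fun x y =>
  let t := T x y
  if x = i ∧ y = j then (match t with | Tile.blank => Tile.se | _ => t)
  else if x = i' ∧ y = j then
    (match t with | Tile.se => Tile.vert | Tile.horiz => Tile.nw | _ => t)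
  else if x = i ∧ y = j + 1 then
    (match t with | Tile.se => Tile.horiz | Tile.vert => Tile.nw | _ => t)
  else if x = i' ∧ y = j + 1 then
    (match t with | Tile.nw => Tile.blank | Tile.cross => Tile.se | _ => t)
  else if y = j ∧ i < x ∧ x < i' then
    (match t with | Tile.blank => Tile.vert | Tile.horiz => Tile.cross | _ => t)
  else if y = j + 1 ∧ i < x ∧ x < i' then
    (match t with | Tile.vert => Tile.blank | Tile.cross => Tile.horiz | _ => t)
  else t

/-- Tile rewrite for the droop (from `(k, j)` into `(k', j+1)`) of a pipe `q` having both
a ⌐-turn and a ⌟-turn in column `j`, performed after the undroop of `p`. -/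
def nablaQDroop (T : ℕ → ℕ → Tile) (k k' j : ℕ) : ℕ → ℕ → Tile := fun x y =>
  let t := T x y
  if x = k ∧ y = j then (match t with | Tile.se => Tile.vert | _ => t)
  else if x = k' ∧ y = j then (match t with | Tile.nw => Tile.cross | _ => t)
  else if x = k ∧ y = j + 1 then (match t with | Tile.horiz => Tile.se | _ => t)
  else if x = k' ∧ y = j + 1 then (match t with | Tile.blank => Tile.nw | _ => t)
  else if y = j + 1 ∧ k < x ∧ x < k' then
    (match t with | Tile.blank => Tile.vert | Tile.horiz => Tile.cross | _ => t)
  else t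

/-- The ⌐/⌟ elbow pairs `(k, k')` of pipes in column `j` strictly between rows `i` and `i'`. -/
def qPairs (g : Grid) (i i' j : ℕ) : List (ℕ × ℕ) :=
  (List.range' 1 g.n).filterMap (fun k =>
    if i < k ∧ k < i' ∧ g.tile k j = Tile.se then
      match (List.range' 1 g.n).find?
          (fun k' => decide (k < k' ∧ k' < i' ∧ g.tile k' j = Tile.nw)) with
      | some k' => some (k, k')
      | none => none
    else none)

/-- One iteration of the marked-tile procedure on the rectangle with corners
`(i, j)` and `(i', j+1)`: undroop `p`, then droop the intersecting pipes. -/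
def nablaIter (g : Grid) (i i' j : ℕ) : Grid :=
  ⟨g.n, (qPairs g i i' j).foldl (fun T kk => nablaQDroop T kk.1 kk.2 j)
    (nablaUndroop g.tile i i' j)⟩

/-- The marked-tile loop of the Gao–Huang procedure; returns `(∇B, a)`. -/
def nablaLoop (g : Grid) : ℕ → ℕ × ℕ → Grid × ℕ
  | 0, _ => (g, 0)
  | fuel + 1, (i, j0) =>
    let j := slideEast g i j0
    match pipeFromS g i (j + 1) with
    | none => (g, 0)
    | some p =>
      if p = j + 1 then
        match (List.range' 1 g.n).find? (fun x =>
            decide (i < x) && (g.tile x (j + 1) == Tile.cross) &&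
            (backAux g (2 * g.n + 2) x (j + 1) false == some j)) with
        | some i' => (nablaIter g i i' j, j)
        | none => (g, 0)
      else
        match (List.range' 1 g.n).find? (fun x =>
            decide (i < x) && (g.tile x (j + 1) == Tile.nw)) with
        | some i' => nablaLoop (nablaIter g i i' j) fuel (i', j + 1)
        | none => (g, 0)

/-- The Gao–Huang procedure: returns `(∇B, (r, a))` where `pop(B) = (r, a)`. -/
def nablaPop (g : Grid) : Grid × ℕ × ℕ :=
  match (List.range' 1 g.n).find?
      (fun i => (List.range' 1 g.n).any (fun j => g.tile i j == Tile.blank)) with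
  | none => (g, 0, 0)
  | some r =>
    let j0 := ((List.range' 1 g.n).filter (fun j => g.tile r j == Tile.blank)).getLastD 0
    let res := nablaLoop g (g.n + 1) (r, j0)
    (res.1, r, res.2)

/-- The Gao–Huang operator `∇`. -/
def nabla (g : Grid) : Grid := (nablaPop g).1

/-- `pop(B) = (r, a)`. -/
def pop (g : Grid) : ℕ × ℕ := (nablaPop g).2

/-- The number of crossing tiles of `g` (which equals `ℓ(w)` for `g ∈ BPD(w)`). -/
def crossCount (g : Grid) : ℕ :=
  ((List.range' 1 g.n).map (fun i =>
    ((List.range' 1 g.n).filter (fun j => g.tile i j == Tile.cross)).length)).sum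

def phiAux : ℕ → Grid → List (ℕ × ℕ)
  | 0, _ => []
  | l + 1, g => pop g :: phiAux l (nabla g)

/-- The Gao–Huang bijection `φ : BPD(w) → PD(w)`,
`φ(B) = (r_1,…,r_l ; a_1,…,a_l)` with `(r_i, a_i) = pop(∇^{i-1} B)`. -/
def phi (g : Grid) : Biword :=
  ⟨(phiAux (crossCount g) g).map Prod.fst, (phiAux (crossCount g) g).map Prod.snd⟩

/-! ### Little bumps (relational) -/

/-- The reflection labelling the crossing at position `m` (0-indexed) of the word `a`:
deleting the letter at position `m` from `a` yields a word for `wordProd a * crossingRefl a m`.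
The wires `i` and `j` cross at position `m` iff `crossingRefl a m = t_{ij}`. -/
def crossingRefl (a : List ℕ) (m : ℕ) : Perm' :=
  (wordProd (a.drop (m + 1)))⁻¹ * sT (a.getD m 0) * wordProd (a.drop (m + 1))

/-- `a` is a reduced word (for its own product). -/
def IsReducedSelf (a : List ℕ) : Prop := IsReducedWord (wordProd a) a

/-- Increment the entry of `a` at position `m`. -/
def incrAt (a : List ℕ) (m : ℕ) : List ℕ := a.set m (a.getD m 0 + 1)

/-- The (upward) Little bump `L_{ij}` as a relation on biwords: starting at the position
`m_1` where wires `i` and `j` cross, repeatedly increment the current entry; stop when the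
bottom word becomes reduced, and otherwise move to the unique other position whose crossing
involves the same pair of wires. -/
def LittleBumpRel (i j : ℕ) (P P' : Biword) : Prop :=
  P'.top = P.top ∧
  ∃ ms : List ℕ, ∃ ws : List (List ℕ),
    ms ≠ [] ∧
    ws.length = ms.length + 1 ∧
    ws.getD 0 [] = P.bot ∧
    ws.getLastD [] = P'.bot ∧
    (∀ t : ℕ, t < ms.length → ws.getD (t + 1) [] = incrAt (ws.getD t []) (ms.getD t 0)) ∧
    crossingRefl P.bot (ms.getD 0 0) = tT i j ∧
    (∀ t : ℕ, t + 1 < ms.length →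
      ¬ IsReducedSelf (ws.getD (t + 1) []) ∧
      ms.getD (t + 1) 0 ≠ ms.getD t 0 ∧
      crossingRefl (ws.getD (t + 1) []) (ms.getD t 0)
        = crossingRefl (ws.getD (t + 1) []) (ms.getD (t + 1) 0)) ∧
    IsReducedSelf P'.bot

/-! ### Huang bumps -/

/-- Least offset `t ≥ 1` satisfying `p` (searched up to `bound + 1`). -/
def leastOff (p : ℕ → Bool) (bound : ℕ) : ℕ :=
  ((List.range' 1 (bound + 1)).filter p).headD 1

/-- The southeast corner `(x + k, y + l)` of the min-droop at `(x, y)`: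
`k, l ≥ 1` minimal with `(x+k, y)` and `(x, y+l)` not crossing tiles. -/
def minDroopCorner (g : Grid) (x y : ℕ) : ℕ × ℕ :=
  (x + leastOff (fun k => !(g.tile (x + k) y == Tile.cross)) g.n,
   y + leastOff (fun l => !(g.tile x (y + l) == Tile.cross)) g.n)

/-- The min-droop at `(x, y)`: droop the ⌐-turn at `(x, y)` into `(x+k, y+l)`. -/
def minDroopT (g : Grid) (x y : ℕ) : Grid :=
  let k := leastOff (fun k => !(g.tile (x + k) y == Tile.cross)) g.n
  let l := leastOff (fun l => !(g.tile x (y + l) == Tile.cross)) g.n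
  ⟨g.n, fun a b =>
    let t := g.tile a b
    if a = x ∧ b = y then
      (match t with | Tile.se => Tile.blank | Tile.bump => Tile.nw | _ => t)
    else if a = x + k ∧ b = y then (match t with | Tile.vert => Tile.se | _ => t)
    else if a = x ∧ b = y + l then
      (match t with | Tile.horiz => Tile.se | Tile.nw => Tile.vert | _ => t)
    else if a = x + k ∧ b = y + l then
      (match t with | Tile.blank => Tile.nw | Tile.se => Tile.bump | _ => t)
    else if b = y ∧ x < a ∧ a < x + k then
      (match t with | Tile.cross => Tile.horiz | Tile.vert => Tile.blank | _ => t)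
    else if a = x ∧ y < b ∧ b < y + l then
      (match t with | Tile.cross => Tile.vert | Tile.horiz => Tile.blank | _ => t)
    else if a = x + k ∧ y < b ∧ b < y + l then
      (match t with | Tile.blank => Tile.horiz | Tile.vert => Tile.cross | _ => t)
    else if b = y + l ∧ x < a ∧ a < x + k then
      (match t with | Tile.blank => Tile.vert | Tile.horiz => Tile.cross | _ => t)
    else t⟩

/-- Replace a single tile. -/
def setTile (g : Grid) (x y : ℕ) (t : Tile) : Grid :=
  ⟨g.n, fun a b => if a = x ∧ b = y then t else g.tile a b⟩

/-- Pipe `c` passes through `(x, y)` (Boolean). -/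
def onPath (g : Grid) (c : ℕ) (x y : ℕ) : Bool :=
  decide ((x, y, Dir.north) ∈ pipePath g c) || decide ((x, y, Dir.east) ∈ pipePath g c)

/-- The position of the crossing tile where pipes `c` and `c'` cross, if any. -/
def findCrossing (g : Grid) (c c' : ℕ) : Option (ℕ × ℕ) :=
  (pipePath g c).findSome? (fun s =>
    if (g.tile s.1 s.2.1 == Tile.cross) && onPath g c' s.1 s.2.1 then some (s.1, s.2.1)
    else none)

/-- The column of the ⌐-turn of pipe `c` in row `row`, if any. -/
def seTurnCol (g : Grid) (c row : ℕ) : Option ℕ :=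
  (pipePath g c).findSome? (fun s =>
    if s.1 = row ∧ s.2.2 = Dir.north ∧
        (g.tile s.1 s.2.1 = Tile.se ∨ g.tile s.1 s.2.1 = Tile.bump) then some s.2.1
    else none)

/-- The iteration of the Huang bump: min-droops and cross-bump-swaps until a bump tile
is turned into a crossing tile. -/
def huangLoop (iPipe : ℕ) : ℕ → Grid → ℕ × ℕ → Grid
  | 0, g, _ => g
  | fuel + 1, g, (x, y) =>
    let c := minDroopCorner g x y
    let g1 := minDroopT g x y
    match g1.tile c.1 c.2 with
    | Tile.nw =>
      match seTurnCol g1 iPipe c.1 with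
      | some col => huangLoop iPipe fuel g1 (c.1, col)
      | none => g1
    | Tile.bump =>
      match backAux g1 (2 * g1.n + 2) c.1 c.2 false with
      | some q =>
        match findCrossing g1 iPipe q with
        | some z =>
          huangLoop iPipe fuel (setTile (setTile g1 c.1 c.2 Tile.cross) z.1 z.2 Tile.bump) z
        | none => setTile g1 c.1 c.2 Tile.cross
      | none => g1
    | _ => g1

/-- Fuel exceeding the number of states of the procedure. -/
def huangFuel (g : Grid) : ℕ := 7 ^ (g.n * g.n) * (g.n * g.n) + 2

/-- The Huang bump `H_{ij}`: replace the crossing of pipes `i` and `j` by a bump tile,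
then repeatedly min-droop and cross-bump-swap until a new crossing tile is created. -/
def huang (i j : ℕ) (g : Grid) : Grid :=
  match findCrossing g i j with
  | some z => huangLoop i (huangFuel g) (setTile g z.1 z.2 Tile.bump) z
  | none => g



/-! ### Inversions -/

/-- The inversion set. -/
def InvSet (w : Perm') : Set (ℕ × ℕ) := {p | p.1 < p.2 ∧ w p.2 < w p.1}

/-- The number of inversions. -/
noncomputable def invN (w : Perm') : ℕ := (InvSet w).ncard

/-- Exchange map on pairs. -/
def phiSw (j k : ℕ) (p : ℕ × ℕ) : ℕ × ℕ :=
  if Equiv.swap j k p.1 < Equiv.swap j k p.2 then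
    (Equiv.swap j k p.1, Equiv.swap j k p.2) else p

theorem phiSw_lt (j k : ℕ) (p : ℕ × ℕ) (hp : p.1 < p.2) : (phiSw j k p).1 < (phiSw j k p).2 := by
  unfold phiSw; split_ifs <;> assumption

theorem phiSw_invol (j k : ℕ) (p : ℕ × ℕ) (hp : p.1 < p.2) : phiSw j k (phiSw j k p) = p := by
  by_cases h : Equiv.swap j k p.1 < Equiv.swap j k p.2
  · have : phiSw j k p = (Equiv.swap j k p.1, Equiv.swap j k p.2) := by simp [phiSw, h]
    rw [this]; simp [phiSw, hp]
  · have : phiSw j k p = p := by simp [phiSw, h]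
    rw [this, this]

theorem phiSw_injOn (j k : ℕ) (S : Set (ℕ × ℕ)) (hS : ∀ p ∈ S, p.1 < p.2) :
    Set.InjOn (phiSw j k) S := by
  intro p hp q hq h
  rw [← phiSw_invol j k p (hS p hp), h, phiSw_invol j k q (hS q hq)]

theorem phiSw_self (j k : ℕ) (h : j < k) : phiSw j k (j, k) = (j, k) := by
  have : ¬ k < j := by omega
  simp [phiSw, this]

theorem inv_strict (u : Perm') (j k : ℕ) (hjk : j < k) (hu : u j < u k)
    (hf : (InvSet (u * Equiv.swap j k)).Finite) :
    invN u + 1 ≤ invN (u * Equiv.swap j k) := by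
  have hmem : (j, k) ∈ InvSet (u * Equiv.swap j k) := by
    simp [InvSet, hjk, hu]
  have h1 : invN u ≤ (InvSet (u * Equiv.swap j k) \ {(j, k)}).ncard := by
    refine Set.ncard_le_ncard_of_injOn (phiSw j k) ?_ ?_ (hf.subset Set.sdiff_subset)
    · rintro ⟨p, q⟩ ⟨hp1, hp2⟩
      simp only at hp1 hp2
      refine ⟨⟨phiSw_lt j k _ hp1, ?_⟩, ?_⟩
      · unfold phiSw
        split_ifs with h
        · simpa using hp2
        · simp only [Equiv.Perm.mul_apply]
          simp only [Equiv.swap_apply_def] at h ⊢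
          grind
      · intro h
        have h2 : phiSw j k (p, q) = (j, k) := h
        have := phiSw_invol j k (p, q) hp1
        rw [h2, phiSw_self j k hjk] at this
        grind
    · exact phiSw_injOn j k _ (fun p hp => hp.1)
  have h2 := Set.ncard_sdiff_singleton_add_one hmem hf
  unfold invN at *
  omega

theorem inv_cover (u : Perm') (j k : ℕ) (hjk : j < k)
    (hc : ∀ x, j < x → x < k → ¬ (u j < u x ∧ u x < u k))
    (hf : (InvSet u).Finite) (hu : u j < u k) :
    invN (u * Equiv.swap j k) ≤ invN u + 1 := by
  have h1 : (InvSet (u * Equiv.swap j k) \ {(j, k)}).ncard ≤ invN u := by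
    refine Set.ncard_le_ncard_of_injOn (phiSw j k) ?_ ?_ hf
    · rintro ⟨p, q⟩ ⟨⟨hp1, hp2⟩, hp3⟩
      simp only at hp1 hp2
      refine ⟨phiSw_lt j k _ hp1, ?_⟩
      unfold phiSw
      split_ifs with h
      · simpa using hp2
      · simp only [Equiv.Perm.mul_apply] at hp2
        simp only [Equiv.swap_apply_def] at h hp2
        have hinj : ∀ x y, u x = u y → x = y := fun x y h => u.injective h
        have := hc p
        have := hc q
        have := hinj p k
        have := hinj q j
        have hp3' : ¬ (p = j ∧ q = k) := by simpa using hp3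
        grind
    · exact phiSw_injOn j k _ (fun p hp => hp.1.1)
  have h2 := Set.ncard_le_ncard_sdiff_add_ncard (InvSet (u * Equiv.swap j k)) {(j, k)}
  rw [Set.ncard_singleton] at h2
  unfold invN at *
  omega

theorem wp_cons (c : ℕ) (y : List ℕ) : wordProd (c :: y) = sT c * wordProd y := by
  simp [wordProd]

theorem wp_nil : wordProd [] = 1 := by simp [wordProd]

theorem wp_append (x y : List ℕ) : wordProd (x ++ y) = wordProd x * wordProd y := by
  simp [wordProd]

theorem sT_mul (c p q : ℕ) (v : Perm') (hp : v p = c) (hq : v q = c + 1) :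
    sT c * v = v * Equiv.swap p q := by
  rw [sT, ← hq, ← hp, Equiv.swap_apply_apply]; group

theorem wp_marker (y1 y2 : List ℕ) (c p q : ℕ) (hp : wordProd y2 p = c)
    (hq : wordProd y2 q = c + 1) :
    wordProd (y1 ++ c :: y2) = wordProd (y1 ++ y2) * Equiv.swap p q := by
  rw [wp_append, wp_cons, sT_mul c p q _ hp hq, wp_append, mul_assoc]

theorem invSet_one : InvSet 1 = ∅ := by
  ext ⟨p, q⟩; simp [InvSet]; omega

theorem invSet_finite (a : List ℕ) : (InvSet (wordProd a)).Finite := by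
  induction a with
  | nil => rw [wp_nil, invSet_one]; exact Set.finite_empty
  | cons c y ih =>
    set v := wordProd y with hv
    refine (ih.union (Set.toFinite {(v.symm c, v.symm (c+1)), (v.symm (c+1), v.symm c)})).subset ?_
    rintro ⟨p, q⟩ ⟨h1, h2⟩
    rw [wp_cons, ← hv] at h2
    simp only [sT, Equiv.Perm.mul_apply, Equiv.swap_apply_def] at h1 h2
    have hinj : v p = v q → p = q := fun h => v.injective h
    by_cases h : v q < v p
    · left; exact ⟨h1, h⟩
    · right
      have : v p = c ∧ v q = c + 1 := by grind
      left
      rw [← this.2, ← this.1]; simp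

theorem inv_up (c : ℕ) (y : List ℕ) (p q : ℕ) (hp : wordProd y p = c) (hq : wordProd y q = c + 1)
    (hpq : p < q) : invN (wordProd (c :: y)) = invN (wordProd y) + 1 := by
  have e : wordProd (c :: y) = wordProd y * Equiv.swap p q := by
    rw [wp_cons, sT_mul c p q _ hp hq]
  have f1 := invSet_finite y
  have f2 := invSet_finite (c :: y)
  rw [e] at f2 ⊢
  apply le_antisymm
  · apply inv_cover _ _ _ hpq _ f1 (by omega)
    intro x _ _; omega
  · exact inv_strict _ _ _ hpq (by omega) f2

theorem inv_down (c : ℕ) (y : List ℕ) (p q : ℕ) (hp : wordProd y p = c) (hq : wordProd y q = c + 1)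
    (hpq : q < p) : invN (wordProd (c :: y)) + 1 = invN (wordProd y) := by
  have h := inv_up c (c :: y) q p (by simp [wp_cons, sT, hq]) (by simp [wp_cons, sT, hp]) hpq
  rw [← h]; congr 1
  simp [wp_cons, sT]

theorem wires (y : List ℕ) (c : ℕ) : ∃ p q, wordProd y p = c ∧ wordProd y q = c + 1 ∧ p ≠ q := by
  refine ⟨(wordProd y).symm c, (wordProd y).symm (c+1), by simp, by simp, ?_⟩
  intro h
  have := (wordProd y).symm.injective h
  omega

theorem inv_le (a : List ℕ) : invN (wordProd a) ≤ a.length := by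
  induction a with
  | nil => rw [wp_nil, invN, invSet_one]; simp
  | cons c y ih =>
    obtain ⟨p, q, hp, hq, hpq⟩ := wires y c
    rcases lt_or_gt_of_ne hpq with h | h
    · have := inv_up c y p q hp hq h; simp; omega
    · have := inv_down c y p q hp hq h; simp; omega

/-- Reducedness by inversion count. -/
def Red (a : List ℕ) : Prop := invN (wordProd a) = a.length

theorem red_cons {c : ℕ} {y : List ℕ} (h : Red (c :: y)) : Red y := by
  unfold Red at *
  have := inv_le y
  obtain ⟨p, q, hp, hq, hpq⟩ := wires y c
  simp only [List.length_cons] at h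
  rcases lt_or_gt_of_ne hpq with h' | h'
  · have := inv_up c y p q hp hq h'; omega
  · have := inv_down c y p q hp hq h'; omega

theorem red_cons_lt {c : ℕ} {y : List ℕ} (h : Red (c :: y)) (p q : ℕ) (hp : wordProd y p = c)
    (hq : wordProd y q = c + 1) : p < q := by
  unfold Red at *
  have := inv_le y
  simp only [List.length_cons] at h
  by_contra hh
  have hpq : p ≠ q := by rintro rfl; omega
  have := inv_down c y p q hp hq (by omega); omega

theorem red_of_lt {c : ℕ} {y : List ℕ} (h : Red y) (p q : ℕ) (hp : wordProd y p = c)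
    (hq : wordProd y q = c + 1) (hpq : p < q) : Red (c :: y) := by
  unfold Red at *
  have := inv_up c y p q hp hq hpq
  simp; omega

theorem red_append {x y : List ℕ} (h : Red (x ++ y)) : Red y := by
  induction x with
  | nil => exact h
  | cons c x ih => exact ih (red_cons h)

theorem not_red_double (x y : List ℕ) (c : ℕ) : ¬ Red (x ++ c :: c :: y) := by
  intro h
  have h1 := red_append h
  have h2 := red_cons h1
  obtain ⟨p, q, hp, hq, hpq⟩ := wires y c
  have a1 := red_cons_lt h2 p q hp hq
  have a2 := red_cons_lt h1 q p (by simp [wp_cons, sT, hq]) (by simp [wp_cons, sT, hp])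
  omega

/-- Inversions persist. -/
theorem persist (z x : List ℕ) (h : Red (z ++ x)) (p q : ℕ) (hpq : p < q)
    (hi : wordProd x q < wordProd x p) : wordProd (z ++ x) q < wordProd (z ++ x) p := by
  induction z with
  | nil => exact hi
  | cons d z ih =>
    have ih := ih (red_cons h)
    have := red_cons_lt (y := z ++ x) h q p
    rw [List.cons_append, wp_cons]
    simp only [sT, Equiv.Perm.mul_apply, Equiv.swap_apply_def]
    grind

/-- Find the crossing. -/
theorem find_cross (z x : List ℕ) (p q : ℕ) (h1 : wordProd x p < wordProd x q)
    (h2 : wordProd (z ++ x) q < wordProd (z ++ x) p) :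
    ∃ z1 c z2, z = z1 ++ c :: z2 ∧ wordProd (z2 ++ x) p = c ∧ wordProd (z2 ++ x) q = c + 1 := by
  induction z with
  | nil => simp at h2; omega
  | cons d z ih =>
    by_cases h : wordProd (z ++ x) q < wordProd (z ++ x) p
    · obtain ⟨z1, c, z2, e, a, b⟩ := ih h
      exact ⟨d :: z1, c, z2, by simp [e], a, b⟩
    · refine ⟨[], d, z, rfl, ?_⟩
      rw [List.cons_append, wp_cons] at h2
      simp only [sT, Equiv.Perm.mul_apply, Equiv.swap_apply_def] at h2
      have hpq : p ≠ q := by rintro rfl; omega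
      have : wordProd (z ++ x) p ≠ wordProd (z ++ x) q := fun h => hpq ((wordProd _).injective h)
      grind

theorem find_cross0 (z : List ℕ) (p q : ℕ) (h1 : p < q)
    (h2 : wordProd z q < wordProd z p) :
    ∃ z1 c z2, z = z1 ++ c :: z2 ∧ wordProd z2 p = c ∧ wordProd z2 q = c + 1 := by
  have := find_cross z [] p q (by simpa [wp_nil] using h1) (by simpa using h2)
  simpa using this

theorem exists_red (a : List ℕ) (ha : ∀ x ∈ a, 1 ≤ x) :
    ∃ b : List ℕ, (∀ x ∈ b, 1 ≤ x) ∧ wordProd b = wordProd a ∧ Red b := by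
  induction a with
  | nil => exact ⟨[], by simp, rfl, by rw [Red, wp_nil, invN, invSet_one]; simp⟩
  | cons c y ih =>
    obtain ⟨b, hb, he, hr⟩ := ih (fun x hx => ha x (by simp [hx]))
    obtain ⟨p, q, hp, hq, hpq⟩ := wires b c
    rcases lt_or_gt_of_ne hpq with h | h
    · refine ⟨c :: b, ?_, by rw [wp_cons, wp_cons, he], red_of_lt hr p q hp hq h⟩
      intro x hx
      rcases List.mem_cons.1 hx with rfl | hx
      · exact ha x (by simp)
      · exact hb x hx
    · obtain ⟨z1, c', z2, e, a1, a2⟩ := find_cross0 b q p h (by omega)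
      have e1 := wp_marker z1 z2 c' q p a1 a2
      rw [← e] at e1
      have e2 : wordProd (c :: b) = wordProd (z1 ++ z2) := by
        rw [wp_cons, sT_mul c p q _ hp hq, e1, Equiv.swap_comm]; simp
      refine ⟨z1 ++ z2, ?_, ?_, ?_⟩
      · intro x hx; apply hb; rw [e]; simp at hx ⊢; tauto
      · rw [← e2, wp_cons, wp_cons, he]
      · have := inv_down c b p q hp hq h
        unfold Red at *
        rw [← e2]
        rw [e] at hr this ⊢
        simp at hr ⊢
        rw [e] at e1
        omega

theorem plen_eq (a : List ℕ) (ha : ∀ x ∈ a, 1 ≤ x) : plen (wordProd a) = invN (wordProd a) := by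
  obtain ⟨b, hb, he, hr⟩ := exists_red a ha
  apply le_antisymm
  · apply Nat.sInf_le
    exact ⟨b, ⟨hb, he⟩, by rw [← he]; exact hr.symm⟩
  · apply le_csInf
    · exact ⟨_, b, ⟨hb, he⟩, rfl⟩
    · rintro m ⟨l, ⟨_, h2⟩, rfl⟩
      rw [← h2]; exact inv_le l

theorem redSelf_iff (a : List ℕ) : IsReducedSelf a ↔ (∀ x ∈ a, 1 ≤ x) ∧ Red a := by
  unfold IsReducedSelf IsReducedWord IsWord Red
  constructor
  · rintro ⟨⟨h, -⟩, h2⟩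
    exact ⟨h, by rw [h2, plen_eq a h]⟩
  · rintro ⟨h, h2⟩
    exact ⟨⟨h, rfl⟩, by rw [plen_eq a h, h2]⟩

theorem isPerm_wp (a : List ℕ) (ha : ∀ x ∈ a, 1 ≤ x) : IsPerm (wordProd a) := by
  induction a with
  | nil => rw [wp_nil]; exact ⟨rfl, by simp⟩
  | cons c y ih =>
    obtain ⟨h0, hf⟩ := ih (fun x hx => ha x (by simp [hx]))
    have hc := ha c (by simp)
    rw [wp_cons]
    constructor
    · simp only [sT, Equiv.Perm.mul_apply, h0]
      rw [Equiv.swap_apply_of_ne_of_ne] <;> omega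
    · refine (hf.union (Set.toFinite {c, c+1})).subset ?_
      intro k hk
      by_cases h : wordProd y k = k
      · right
        simp only [sT, Set.mem_ofPred_eq, Equiv.Perm.mul_apply, h, Equiv.swap_apply_def] at hk
        simp; grind
      · left; exact h

/-! ### The potential -/

/-- Sum of the rows visited by a wire. -/
def rowSum : List ℕ → ℕ → ℕ
  | [], _ => 0
  | c :: y, x => wordProd (c :: y) x + rowSum y x

theorem rowSum_append (y1 y2 : List ℕ) (x : ℕ) :
    rowSum (y1 ++ y2) x = rowSum y1 (wordProd y2 x) + rowSum y2 x := by
  induction y1 with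
  | nil => simp [rowSum]
  | cons c y ih =>
    simp only [List.cons_append, rowSum, ih, wp_cons, wp_append, Equiv.Perm.mul_apply]
    omega

theorem wp_le (y : List ℕ) (x : ℕ) : wordProd y x ≤ x + y.length := by
  induction y with
  | nil => simp [wp_nil]
  | cons c y ih =>
    rw [wp_cons]
    simp only [sT, Equiv.Perm.mul_apply, Equiv.swap_apply_def, List.length_cons]
    grind

theorem rowSum_le (y : List ℕ) (x : ℕ) : rowSum y x ≤ y.length * (x + y.length) := by
  induction y with
  | nil => simp [rowSum]
  | cons c y ih =>
    have := wp_le (c :: y) x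
    simp only [rowSum, List.length_cons] at *
    nlinarith

theorem rowSum_mono_inv (z x : List ℕ) (h : Red (z ++ x)) (p q : ℕ) (hpq : p < q)
    (hi : wordProd x q < wordProd x p) :
    rowSum z (wordProd x q) ≤ rowSum z (wordProd x p) := by
  induction z with
  | nil => simp [rowSum]
  | cons d z ih =>
    have ih := ih (red_cons h)
    have h1 := persist (d :: z) x h p q hpq hi
    rw [wp_append] at h1
    simp only [rowSum]
    simp only [Equiv.Perm.mul_apply] at h1
    omega

theorem rowSum_mono_noninv (z x : List ℕ) (h : Red (z ++ x)) (p q : ℕ) (hpq : p < q)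
    (hi : wordProd (z ++ x) p < wordProd (z ++ x) q) :
    rowSum z (wordProd x p) ≤ rowSum z (wordProd x q) := by
  induction z with
  | nil => simp [rowSum]
  | cons d z ih =>
    have hlt : wordProd (z ++ x) p < wordProd (z ++ x) q := by
      by_contra hh
      have hne : wordProd (z ++ x) p ≠ wordProd (z ++ x) q := fun h => by
        have := (wordProd _).injective h; omega
      have := persist [d] (z ++ x) h p q hpq (by omega)
      simp only [List.cons_append, List.nil_append] at this hi
      omega
    have ih := ih (red_cons h) hlt
    rw [wp_append] at hi
    simp only [rowSum]
    simp only [Equiv.Perm.mul_apply] at hi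
    omega

/-- Potential of a marked word. -/
def pot (j : ℕ) (y1 : List ℕ) (c : ℕ) (y2 : List ℕ) : ℕ :=
  rowSum y1 (c + 1) + (c + 1) + rowSum y2 j

theorem pot_le (j c n : ℕ) (y1 y2 : List ℕ) (hj : wordProd y2 j = c + 1)
    (hn : y1.length + y2.length = n) : pot j y1 c y2 ≤ (n + n + 1) * (j + n + n) := by
  have h1 := wp_le y2 j
  have h2 := rowSum_le y1 (c + 1)
  have h3 := rowSum_le y2 j
  have h4 : y1.length * (c + 1 + y1.length) ≤ n * (j + n + n) :=
    Nat.mul_le_mul (by omega) (by omega)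
  have h5 : y2.length * (j + y2.length) ≤ n * (j + n + n) :=
    Nat.mul_le_mul (by omega) (by omega)
  unfold pot
  nlinarith

/-! ### One step of the bump -/

/-- The result of a finished bump. -/
def Done (u : Perm') (j : ℕ) (v : Perm') : Prop :=
  ∃ k, j < k ∧ u j < u k ∧ (∀ x, j < x → x < k → ¬ (u j < u x ∧ u x < u k)) ∧
    v = u * Equiv.swap j k

theorem red_of_eq {a b : List ℕ} (h : Red a) (he : wordProd a = wordProd b)
    (hl : a.length = b.length) : Red b := by
  unfold Red at *; rw [← he, ← hl]; exact h

theorem step_done (u : Perm') (j c : ℕ) (y1 y2 : List ℕ) (hr : Red (y1 ++ y2))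
    (hu : wordProd (y1 ++ y2) = u) (hj : wordProd y2 j = c + 1)
    (hd : Red (y1 ++ (c + 1) :: y2)) : Done u j (wordProd (y1 ++ (c + 1) :: y2)) := by
  obtain ⟨k, hk⟩ := (wordProd y2).surjective (c + 1 + 1)
  have e := wp_marker y1 y2 (c + 1) j k hj hk
  have hjk : j < k := red_cons_lt (red_append hd) j k hj hk
  have hujk : u j < u k := by
    by_contra hh
    have hne : u j ≠ u k := fun h => by have := u.injective h; omega
    have f := invSet_finite (y1 ++ y2)
    have := inv_strict (u * Equiv.swap j k) j k hjk (by simp; omega)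
      (by simpa [mul_assoc, hu] using f)
    unfold Red at hr hd
    rw [e, hu] at hd
    rw [hu] at hr
    simp [mul_assoc] at this hd hr
    omega
  refine ⟨k, hjk, hujk, ?_, by rw [e, hu]⟩
  rintro x hx1 hx2 ⟨h1, h2⟩
  have n1 : wordProd y2 x ≠ wordProd y2 j := fun h => by
    have := (wordProd _).injective h; omega
  have n2 : wordProd y2 x ≠ wordProd y2 k := fun h => by
    have := (wordProd _).injective h; omega
  rcases lt_or_ge (wordProd y2 x) (c + 1) with h | h
  · have := persist y1 y2 hr j x hx1 (by omega)
    rw [hu] at this; omega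
  · have := persist y1 y2 hr x k hx2 (by omega)
    rw [hu] at this; omega

theorem step_cont (u : Perm') (j c : ℕ) (y1 y2 : List ℕ) (hr : Red (y1 ++ y2))
    (hu : wordProd (y1 ++ y2) = u) (hj : wordProd y2 j = c + 1)
    (hd : ¬ Red (y1 ++ (c + 1) :: y2)) :
    ∃ y1' c' y2', y1 ++ (c + 1) :: y2 = y1' ++ c' :: y2' ∧ Red (y1' ++ y2') ∧
      wordProd (y1' ++ y2') = u ∧ wordProd y2' j = c' + 1 ∧ y1'.length ≠ y1.length ∧
      (∃ k, wordProd y2 k = c + 1 + 1 ∧ wordProd y2' k = c') ∧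
      pot j y1 c y2 < pot j y1' c' y2' ∧
      (∀ x, y1' = x ++ [c'] → x.length = y1.length) := by
  obtain ⟨k, hk⟩ := (wordProd y2).surjective (c + 1 + 1)
  have e := wp_marker y1 y2 (c + 1) j k hj hk
  have hne : j ≠ k := by rintro rfl; omega
  rcases lt_or_gt_of_ne hne with hjk | hjk
  · -- crossing in `y1`
    have hujk : u k < u j := by
      by_contra hh
      have hne' : u j ≠ u k := fun h => hne (u.injective h)
      apply hd
      have f := invSet_finite (y1 ++ (c + 1) :: y2)
      rw [e, hu] at f
      have h1 := inv_strict u j k hjk (by omega) f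
      have h2 := inv_le (y1 ++ (c + 1) :: y2)
      unfold Red at hr ⊢
      rw [e, hu] at h2 ⊢
      rw [hu] at hr
      simp at *
      omega
    obtain ⟨z1, c', z2, ez, a1, a2⟩ := find_cross y1 y2 j k (by omega) (by rw [hu]; exact hujk)
    have hb : wordProd (z2 ++ (c + 1) :: y2) = wordProd (z2 ++ y2) * Equiv.swap j k :=
      wp_marker z2 y2 (c + 1) j k hj hk
    have b1 : wordProd (z2 ++ (c + 1) :: y2) j = c' + 1 := by rw [hb]; simpa using a2
    have b2 : wordProd (z2 ++ (c + 1) :: y2) k = c' := by rw [hb]; simpa using a1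
    have e2 := wp_marker z1 (z2 ++ (c + 1) :: y2) c' k j b2 b1
    have e3 : wordProd (z1 ++ (z2 ++ (c + 1) :: y2)) = u := by
      have : y1 ++ (c + 1) :: y2 = z1 ++ c' :: (z2 ++ (c + 1) :: y2) := by simp [ez]
      rw [← this, e, hu, Equiv.swap_comm] at e2
      exact (mul_right_cancel e2).symm
    refine ⟨z1, c', z2 ++ (c + 1) :: y2, by simp [ez], ?_, e3, b1, by simp [ez], ⟨k, hk, b2⟩, ?_, ?_⟩
    · apply red_of_eq hr (by rw [e3, hu])
      simp [ez]; omega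
    · subst ez
      have hr2 : Red (z2 ++ y2) := by
        apply red_append (x := z1 ++ [c'])
        simpa using hr
      have m := rowSum_mono_noninv z2 y2 hr2 j k hjk (by omega)
      rw [hj, hk] at m
      have r1 : wordProd z2 (c + 1) = c' := by
        rw [wp_append, Equiv.Perm.mul_apply, hj] at a1; exact a1
      unfold pot
      simp only [rowSum_append, rowSum, wp_cons, Equiv.Perm.mul_apply, r1, hj]
      simp only [sT, Equiv.swap_apply_left]
      omega
    · intro x hx
      exfalso
      subst ez hx
      apply not_red_double x (z2 ++ y2) c'
      simpa using hr
  · -- crossing in `y2`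
    obtain ⟨z1, c', z2, ez, a1, a2⟩ := find_cross0 y2 k j hjk (by omega)
    have e2 := wp_marker (y1 ++ (c + 1) :: z1) z2 c' k j a1 a2
    have e3 : wordProd (y1 ++ (c + 1) :: z1 ++ z2) = u := by
      have : y1 ++ (c + 1) :: y2 = y1 ++ (c + 1) :: z1 ++ c' :: z2 := by simp [ez]
      rw [← this, e, hu, Equiv.swap_comm] at e2
      exact (mul_right_cancel e2).symm
    refine ⟨y1 ++ (c + 1) :: z1, c', z2, by simp [ez], ?_, e3, a2, by simp, ⟨k, hk, a1⟩, ?_, ?_⟩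
    · apply red_of_eq hr (by rw [e3, hu])
      simp [ez]; omega
    · subst ez
      have hr2 : Red (z1 ++ c' :: z2) := red_append hr
      have c1 : wordProd (c' :: z2) j = c' := by simp [wp_cons, sT, a2]
      have c2 : wordProd (c' :: z2) k = c' + 1 := by simp [wp_cons, sT, a1]
      have m := rowSum_mono_inv z1 (c' :: z2) hr2 k j hjk (by omega)
      rw [c1, c2] at m
      have r1 : wordProd z1 (c' + 1) = c + 1 + 1 := by
        rw [wp_append, Equiv.Perm.mul_apply, c2] at hk; exact hk
      unfold pot
      simp only [rowSum_append, rowSum, wp_cons, Equiv.Perm.mul_apply, r1, a2]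
      simp only [sT, Equiv.swap_apply_left, Equiv.swap_apply_right]
      omega
    · intro x hx
      rcases List.eq_nil_or_concat z1 with rfl | ⟨z, d, rfl⟩
      · have := congrArg List.length hx
        simp at this; omega
      · exfalso
        have hx' : (y1 ++ (c + 1) :: z) ++ [d] = x ++ [c'] := by simpa using hx
        have hd' := List.append_inj_right' hx' (by simp)
        simp at hd'
        subst ez hd'
        apply not_red_double (y1 ++ z) z2 d
        simpa using hr

theorem cr_marker (y1 y2 : List ℕ) (c p q : ℕ) (hp : wordProd y2 p = c)
    (hq : wordProd y2 q = c + 1) : crossingRefl (y1 ++ c :: y2) y1.length = Equiv.swap p q := by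
  unfold crossingRefl
  have : (y1 ++ c :: y2).drop (y1.length + 1) = y2 := by simp [List.drop_append]
  rw [this]
  simp only [List.getD_eq_getElem?_getD]
  simp
  rw [mul_assoc, sT_mul c p q _ hp hq]; simp

theorem incr_marker (y1 y2 : List ℕ) (c : ℕ) :
    incrAt (y1 ++ c :: y2) y1.length = y1 ++ (c + 1) :: y2 := by
  simp [incrAt]

theorem forall2_marker (y1 y2 : List ℕ) (c : ℕ) :
    List.Forall₂ (· ≤ ·) (y1 ++ c :: y2) (y1 ++ (c + 1) :: y2) := by
  have h : ∀ l : List ℕ, List.Forall₂ (· ≤ ·) l l := fun l => List.forall₂_refl l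
  exact List.rel_append (h y1) (List.Forall₂.cons (by omega) (h y2))

theorem forall2_trans : ∀ a b c : List ℕ, List.Forall₂ (· ≤ ·) a b → List.Forall₂ (· ≤ ·) b c →
    List.Forall₂ (· ≤ ·) a c := by
  intro a b c h
  induction h generalizing c with
  | nil => exact id
  | cons hab _ ih =>
    intro h'
    cases h' with
    | cons h1 h2 => exact List.Forall₂.cons (le_trans hab h1) (ih _ h2)

/-! ### The whole bump -/

theorem getD_marker (y1 y2 : List ℕ) (c t : ℕ) :
    (y1 ++ (c + 1) :: y2).getD t 0 =
      if t = y1.length then c + 1 else (y1 ++ c :: y2).getD t 0 := by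
  rw [← incr_marker, incrAt]
  simp only [List.getD_eq_getElem?_getD, List.getElem?_set]
  by_cases h : y1.length = t
  · subst h; simp
  · simp [h, Ne.symm h]

theorem getD_marker_self (y1 y2 : List ℕ) (c : ℕ) :
    (y1 ++ c :: y2).getD y1.length 0 = c := by
  simp

theorem asc_step (St : ℕ → Prop) (y1 y2 : List ℕ) (c : ℕ)
    (h1 : ∀ m, m + 1 < (y1 ++ c :: y2).length →
      (y1 ++ c :: y2).getD m 0 < (y1 ++ c :: y2).getD (m + 1) 0 → St m)
    (h2 : ∀ x, y1 = x ++ [c] → St x.length) :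
    ∀ m, m + 1 < (y1 ++ (c + 1) :: y2).length →
      (y1 ++ (c + 1) :: y2).getD m 0 < (y1 ++ (c + 1) :: y2).getD (m + 1) 0 → St m := by
  intro m hm hlt
  rw [getD_marker, getD_marker] at hlt
  have hm' : m + 1 < (y1 ++ c :: y2).length := by simpa using hm
  have hs := getD_marker_self y1 y2 c
  by_cases e1 : m = y1.length
  · subst e1
    have : ¬ (y1.length + 1 = y1.length) := by omega
    simp only [if_true, if_neg this] at hlt
    exact h1 _ hm' (by omega)
  · by_cases e2 : m + 1 = y1.length
    · simp only [if_neg e1, if_pos e2] at hlt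
      rcases List.eq_nil_or_concat y1 with rfl | ⟨z, d, rfl⟩
      · simp at e2
      · simp at e2
        subst e2
        have hd : ((z ++ [d]) ++ c :: y2).getD z.length 0 = d := by simp
        simp only [List.concat_eq_append] at *
        rw [hd] at hlt
        by_cases hdc : d = c
        · subst hdc; exact h2 z rfl
        · apply h1 _ hm'
          rw [hd]
          have : z.length + 1 = (z ++ [d]).length := by simp
          rw [this, hs]; omega
    · simp only [if_neg e1, if_neg e2] at hlt
      exact h1 _ hm' hlt

theorem bump_run (St : ℕ → Prop) (u : Perm') (j n : ℕ) : ∀ (N : ℕ) (y1 : List ℕ) (c : ℕ)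
    (y2 : List ℕ), Red (y1 ++ y2) → wordProd (y1 ++ y2) = u → wordProd y2 j = c + 1 →
    y1.length + y2.length = n → (n + n + 1) * (j + n + n) ≤ N + pot j y1 c y2 →
    (∀ x ∈ y1 ++ c :: y2, 1 ≤ x) →
    (∀ m, m + 1 < (y1 ++ c :: y2).length →
      (y1 ++ c :: y2).getD m 0 < (y1 ++ c :: y2).getD (m + 1) 0 → St m) →
    (∀ x, y1 = x ++ [c] → St x.length) →
    ∃ (ms : List ℕ) (ws : List (List ℕ)) (b : List ℕ),
      ms ≠ [] ∧ ws.length = ms.length + 1 ∧ ws.getD 0 [] = y1 ++ c :: y2 ∧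
      ws.getLastD [] = b ∧
      (∀ t : ℕ, t < ms.length → ws.getD (t + 1) [] = incrAt (ws.getD t []) (ms.getD t 0)) ∧
      ms.getD 0 0 = y1.length ∧
      (∀ t : ℕ, t + 1 < ms.length →
        ¬ IsReducedSelf (ws.getD (t + 1) []) ∧
        ms.getD (t + 1) 0 ≠ ms.getD t 0 ∧
        crossingRefl (ws.getD (t + 1) []) (ms.getD t 0)
          = crossingRefl (ws.getD (t + 1) []) (ms.getD (t + 1) 0)) ∧
      IsReducedSelf b ∧ List.Forall₂ (· ≤ ·) (y1 ++ c :: y2) b ∧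
      (∀ m, m + 1 < b.length → b.getD m 0 < b.getD (m + 1) 0 → St m) ∧
      Done u j (wordProd b) := by
  intro N
  induction N with
  | zero =>
    intro y1 c y2 hr hu hj hn hN hpos h1 h2
    -- maximal potential: the step must finish
    by_cases hd : Red (y1 ++ (c + 1) :: y2)
    · refine ⟨[y1.length], [y1 ++ c :: y2, y1 ++ (c + 1) :: y2], y1 ++ (c + 1) :: y2, by simp,
        by simp, by simp, by simp, ?_, by simp, by simp, ?_, forall2_marker _ _ _,
        asc_step St y1 y2 c h1 h2, step_done u j c y1 y2 hr hu hj hd⟩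
      · intro t ht
        obtain rfl : t = 0 := by simpa using ht
        simpa using (incr_marker y1 y2 c).symm
      · rw [redSelf_iff]
        refine ⟨?_, hd⟩
        intro x hx
        have h := hpos x
        simp at hx h
        grind
    · exfalso
      obtain ⟨y1', c', y2', he, hr', hu', hj', hne, hk, hp, hI⟩ := step_cont u j c y1 y2 hr hu hj hd
      have := congrArg List.length he
      simp at this
      have := pot_le j c' n y1' y2' hj' (by omega)
      omega
  | succ N ih =>
    intro y1 c y2 hr hu hj hn hN hpos h1 h2
    have hpos' : ∀ x ∈ y1 ++ (c + 1) :: y2, 1 ≤ x := by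
      intro x hx
      have h := hpos x
      simp at hx h
      grind
    by_cases hd : Red (y1 ++ (c + 1) :: y2)
    · refine ⟨[y1.length], [y1 ++ c :: y2, y1 ++ (c + 1) :: y2], y1 ++ (c + 1) :: y2, by simp,
        by simp, by simp, by simp, ?_, by simp, by simp, ?_, forall2_marker _ _ _,
        asc_step St y1 y2 c h1 h2, step_done u j c y1 y2 hr hu hj hd⟩
      · intro t ht
        obtain rfl : t = 0 := by simpa using ht
        simpa using (incr_marker y1 y2 c).symm
      · rw [redSelf_iff]
        exact ⟨hpos', hd⟩
    · obtain ⟨y1', c', y2', he, hr', hu', hj', hne, ⟨k, hk, hk'⟩, hp, hI⟩ :=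
        step_cont u j c y1 y2 hr hu hj hd
      have hlen := congrArg List.length he
      simp at hlen
      have hasc := asc_step St y1 y2 c h1 h2
      obtain ⟨ms, ws, b, g1, g2, g3, g4, g5, g6, g7, g8, g9, g10, g11⟩ :=
        ih y1' c' y2' hr' hu' hj' (by omega) (by omega) (by rw [← he]; exact hpos')
          (by rw [← he]; exact hasc) (by
            intro x hx
            have hxl := hI x hx
            subst hx
            rw [hxl]
            have q1 : (y1 ++ (c + 1) :: y2).getD y1.length 0 = c' := by
              rw [he, ← hxl]; simp
            have q2 : (y1 ++ (c + 1) :: y2).getD (y1.length + 1) 0 = c' := by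
              rw [he, ← hxl]; simp
            have hnn : ¬ (y1.length + 1 = y1.length) := by omega
            rw [getD_marker, if_pos rfl] at q1
            rw [getD_marker, if_neg hnn] at q2
            apply h1
            · simp at hlen ⊢; omega
            · rw [getD_marker_self, q2]; omega)
      rw [← he] at g3 g9
      refine ⟨y1.length :: ms, (y1 ++ c :: y2) :: ws, b, by simp, by simp [g2], by simp, ?_, ?_,
        by simp, ?_, g8, ?_, g10, g11⟩
      · cases ws with
        | nil => simp at g2
        | cons w0 ws => simpa using g4
      · intro t ht
        cases t with
        | zero =>
          simp only [List.getD_cons_succ, List.getD_cons_zero]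
          rw [g3, incr_marker]
        | succ t =>
          simp only [List.getD_cons_succ]
          exact g5 t (by simpa using ht)
      · intro t ht
        cases t with
        | zero =>
          simp only [List.getD_cons_succ, List.getD_cons_zero]
          rw [g3, g6]
          refine ⟨?_, hne, ?_⟩
          · rw [redSelf_iff]; tauto
          · rw [cr_marker y1 y2 (c + 1) j k hj hk, he, cr_marker y1' y2' c' k j hk' hj',
              Equiv.swap_comm]
        | succ t =>
          simp only [List.getD_cons_succ]
          exact g7 t (by simpa using ht)
      · exact forall2_trans _ _ _ (forall2_marker y1 y2 c) g9

theorem bump_exists (P : Biword) (hP : IsCompatible (wordProd P.bot) P) (i r : ℕ) (hir : i < r)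
    (hw : wordProd P.bot r < wordProd P.bot i)
    (hc : ∀ x, i < x → x < r → ¬ (wordProd P.bot r < wordProd P.bot x ∧
      wordProd P.bot x < wordProd P.bot i)) :
    ∃ P' : Biword, LittleBumpRel i r P P' ∧ IsCompatible (wordProd P'.bot) P' ∧
      Done (wordProd P.bot * Equiv.swap i r) r (wordProd P'.bot) := by
  obtain ⟨hred, hchain, hforall, hasc⟩ := hP
  have hred' := (redSelf_iff P.bot).1 hred
  obtain ⟨hpos, hR⟩ := hred'
  obtain ⟨y1, c, y2, e, a1, a2⟩ := find_cross0 P.bot i r hir hw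
  have em := wp_marker y1 y2 c i r a1 a2
  rw [← e] at em
  have hu : wordProd (y1 ++ y2) = wordProd P.bot * Equiv.swap i r := by
    rw [em, mul_assoc, Equiv.swap_mul_self, mul_one]
  have hRed : Red (y1 ++ y2) := by
    have h1 := inv_cover (wordProd (y1 ++ y2)) i r hir (by
      rw [hu]
      intro x hx1 hx2
      have := hc x hx1 hx2
      simp only [Equiv.Perm.mul_apply, Equiv.swap_apply_left, Equiv.swap_apply_right]
      rw [Equiv.swap_apply_of_ne_of_ne (by omega) (by omega)]
      exact this) (invSet_finite _) (by rw [hu]; simpa using hw)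
    rw [← em] at h1
    have h2 := inv_le (y1 ++ y2)
    unfold Red at *
    rw [hR, e] at h1
    simp at *
    omega
  obtain ⟨ms, ws, b, g1, g2, g3, g4, g5, g6, g7, g8, g9, g10, g11⟩ :=
    bump_run (fun m => P.top.getD m 0 < P.top.getD (m + 1) 0) (wordProd P.bot * Equiv.swap i r) r
      (y1.length + y2.length) _ y1 c y2 hRed hu a2 rfl (Nat.le_add_right _ _)
      (by rw [← e]; exact hpos) (by rw [← e]; exact hasc) (by
        intro x hx
        exfalso
        subst hx
        apply not_red_double x y2 c
        rw [e] at hR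
        simpa using hR)
  refine ⟨⟨P.top, b⟩, ⟨rfl, ms, ws, g1, g2, by rw [g3, e], g4, g5, ?_, g7, g8⟩,
    ⟨g8, hchain, ?_, g10⟩, g11⟩
  · rw [g6, e, cr_marker y1 y2 c i r a1 a2]; rfl
  · rw [← e] at g9
    exact forall2_trans _ _ _ hforall g9

/-! ### Iterating bumps -/

theorem outer (D : ℕ) : ∀ (n d i : ℕ) (P : Biword), IsCompatible (wordProd P.bot) P →
    (∀ x, D < x → wordProd P.bot x < wordProd P.bot (x + 1)) →
    (∀ x, x < d → wordProd P.bot x < wordProd P.bot (x + 1)) →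
    (∀ x, x < i → wordProd P.bot x < wordProd P.bot (d + 1)) →
    i ≤ D + 1 → (D + 2) * (D + 2) ≤ n + (d * (D + 2) + i) →
    ∃ P', Relation.ReflTransGen (fun P P' => ∃ i j, LittleBumpRel i j P P') P P' ∧
      IsCompatible (wordProd P'.bot) P' ∧ Grassmannian (wordProd P'.bot) := by
  intro n
  induction n with
  | zero =>
    intro d i P hP hD hd hi hiD hn
    refine ⟨P, .refl, hP, isPerm_wp _ hP.1.1.1, ?_⟩
    intro a ha b hb
    exfalso
    have h1 : D < d := by nlinarith
    have := hd a
    have := hD a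
    have := ha.2
    omega
  | succ n ih =>
    intro d i P hP hD hd hi hiD hn
    have hperm := isPerm_wp _ hP.1.1.1
    by_cases hG : Grassmannian (wordProd P.bot)
    · exact ⟨P, .refl, hP, hG⟩
    set w := wordProd P.bot with hw
    have hns : ¬ Set.Subsingleton {k | Descent w k} := fun h => hG ⟨hperm, h⟩
    have hex : ∃ x, w (x + 1) < w x := by
      by_contra hh
      apply hns
      intro a ha
      exact absurd ⟨a, ha.2⟩ hh
    classical
    set d0 := Nat.find hex with hd0
    have hd0' : w (d0 + 1) < w d0 := Nat.find_spec hex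
    have hinj : ∀ x y, w x = w y → x = y := fun x y h => w.injective h
    have hinc : ∀ x, x < d0 → w x < w (x + 1) := by
      intro x hx
      have h1 := Nat.find_min hex hx
      have h2 := hinj x (x + 1)
      omega
    have hinc2 : ∀ x y, x < y → y ≤ d0 → w x < w y := by
      intro x y hxy
      induction y with
      | zero => omega
      | succ y ihy =>
        intro hy
        have := hinc y (by omega)
        rcases Nat.lt_or_ge x y with h | h
        · have := ihy h (by omega); omega
        · obtain rfl : x = y := by omega
          exact this
    have hd0D : d0 + 1 ≤ D := by
      by_contra hh
      apply hns
      have key : ∀ a, Descent w a → a = d0 := by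
        intro a ha
        have h1 := Nat.find_min' hex ha.2
        have h2 := hD a
        have := ha.2
        omega
      intro a ha b hb
      rw [key a ha, key b hb]
    have hex2 : ∃ x, w (d0 + 1) < w x := ⟨d0, hd0'⟩
    set i0 := Nat.find hex2 with hi0
    have hi0' : w (d0 + 1) < w i0 := Nat.find_spec hex2
    have hi0d : i0 ≤ d0 := Nat.find_min' hex2 hd0'
    have hi0m : ∀ x, x < i0 → w x < w (d0 + 1) := by
      intro x hx
      have h1 := Nat.find_min hex2 hx
      have h2 := hinj x (d0 + 1)
      omega
    obtain ⟨P', hL, hC, k, hk1, hk2, hk3, hk4⟩ := bump_exists P hP i0 (d0 + 1) (by omega)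
      (by rw [← hw]; exact hi0') (by
        rw [← hw]
        intro x hx1 hx2 hx3
        have := hinc2 i0 x hx1 (by omega)
        omega)
    rw [← hw] at hk2 hk3 hk4
    simp only [Equiv.Perm.mul_apply, Equiv.swap_apply_right] at hk2 hk3
    have uk : ∀ x, x ≠ i0 → x ≠ d0 + 1 → Equiv.swap i0 (d0 + 1) x = x :=
      fun x h1 h2 => Equiv.swap_apply_of_ne_of_ne h1 h2
    rw [uk k (by omega) (by omega)] at hk2 hk3
    have v1 : wordProd P'.bot i0 = w (d0 + 1) := by
      rw [hk4]; simp only [Equiv.Perm.mul_apply]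
      rw [Equiv.swap_apply_of_ne_of_ne (a := d0 + 1) (b := k) (x := i0) (by omega) (by omega),
        Equiv.swap_apply_left]
    have v2 : wordProd P'.bot (d0 + 1) = w k := by
      rw [hk4]; simp only [Equiv.Perm.mul_apply]
      rw [Equiv.swap_apply_left, uk k (by omega) (by omega)]
    have v3 : wordProd P'.bot k = w i0 := by
      rw [hk4]; simp only [Equiv.Perm.mul_apply]
      rw [Equiv.swap_apply_right, Equiv.swap_apply_right]
    have v4 : ∀ x, x ≠ i0 → x ≠ d0 + 1 → x ≠ k → wordProd P'.bot x = w x := by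
      intro x h1 h2 h3
      rw [hk4]; simp only [Equiv.Perm.mul_apply]
      rw [Equiv.swap_apply_of_ne_of_ne h2 h3, uk x h1 h2]
    obtain ⟨Q, hQ1, hQ2, hQ3⟩ := ih d0 (i0 + 1) P' hC (by
        intro x hx
        have hDx := hD x hx
        by_cases e1 : x = k
        · subst e1
          rw [v3, v4 (x + 1) (by omega) (by omega) (by omega)]; omega
        · by_cases e2 : x + 1 = k
          · rw [e2, v3, v4 x (by omega) (by omega) e1]
            have h3 := hk3 x (by omega) (by omega)
            rw [uk x (by omega) (by omega)] at h3
            have h4 := hinj x i0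
            rw [e2] at hDx
            omega
          · rw [v4 x (by omega) (by omega) e1, v4 (x + 1) (by omega) (by omega) e2]; exact hDx)
      (by
        intro x hx
        have hx' := hinc x hx
        by_cases e1 : x = i0
        · rw [e1, v1, v4 (i0 + 1) (by omega) (by omega) (by omega)]
          rw [e1] at hx'; omega
        · by_cases e2 : x + 1 = i0
          · rw [e2, v1, v4 x e1 (by omega) (by omega)]
            exact hi0m x (by omega)
          · rw [v4 x e1 (by omega) (by omega), v4 (x + 1) e2 (by omega) (by omega)]; exact hx')
      (by
        intro x hx
        rw [v2]
        by_cases e1 : x = i0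
        · rw [e1, v1]; omega
        · rw [v4 x e1 (by omega) (by omega)]
          have := hi0m x (by omega)
          omega)
      (by omega) (by
        have hdd : d ≤ d0 := by
          by_contra hh
          have := hd d0 (by omega)
          omega
        rcases Nat.lt_or_ge d d0 with h | h
        · have : (d + 1) * (D + 2) ≤ d0 * (D + 2) := Nat.mul_le_mul_right _ h
          rw [Nat.add_mul] at this
          omega
        · obtain rfl' : d = d0 := by omega
          have : i ≤ i0 := by
            by_contra hh
            have h1 := hi i0 (by omega)
            rw [rfl'] at h1
            omega
          rw [rfl'] at hn
          omega)
    exact ⟨Q, .head ⟨_, _, hL⟩ hQ1, hQ2, hQ3⟩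

theorem seq_of_reach (P P' : Biword)
    (h : Relation.ReflTransGen (fun P P' => ∃ i j, LittleBumpRel i j P P') P P') :
    ∃ (k : ℕ) (bumps : Fin k → ℕ × ℕ) (Ps : Fin (k + 1) → Biword), Ps 0 = P ∧
      (∀ t : Fin k, LittleBumpRel (bumps t).1 (bumps t).2 (Ps t.castSucc) (Ps t.succ)) ∧
      Ps (Fin.last k) = P' := by
  induction h using Relation.ReflTransGen.head_induction_on with
  | refl => exact ⟨0, Fin.elim0, fun _ => P', rfl, fun t => t.elim0, rfl⟩
  | head h1 h2 ih =>
    rename_i A B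
    obtain ⟨i, j, hij⟩ := h1
    obtain ⟨k, bumps, Ps, e0, es, el⟩ := ih
    refine ⟨k + 1, Fin.cons (i, j) bumps, Fin.cons A Ps, rfl, ?_, ?_⟩
    · intro t
      refine Fin.cases ?_ (fun t => ?_) t
      · simpa [e0] using hij
      · simpa using es t
    · rw [← Fin.succ_last, Fin.cons_succ, el]

/-- For any permutation `w` and any `(r ; a) ∈ PD(w)`, there exist a
Grassmannian permutation `v` and a finite sequence of Little bumps taking `(r ; a)` to an
element of `PD(v)`. -/
theorem stmt7 (w : Perm') (hw : IsPerm w) (P : Biword) (hP : IsCompatible w P) :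
    ∃ (v : Perm') (k : ℕ) (bumps : Fin k → ℕ × ℕ) (Ps : Fin (k + 1) → Biword),
      Grassmannian v ∧ Ps 0 = P ∧
      (∀ t : Fin k, LittleBumpRel (bumps t).1 (bumps t).2 (Ps t.castSucc) (Ps t.succ)) ∧
      IsCompatible v (Ps (Fin.last k)) := by
  obtain ⟨hred, hrest⟩ := hP
  have hwp : wordProd P.bot = w := hred.1.2
  subst hwp
  have hfin := hw.2
  obtain ⟨D, hD⟩ := hfin.bddAbove
  have hfix : ∀ x, D < x → wordProd P.bot x = x := by
    intro x hx
    by_contra hh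
    have := hD (show x ∈ {k | wordProd P.bot k ≠ k} from hh)
    omega
  obtain ⟨P', hreach, hC, hG⟩ := outer D ((D + 2) * (D + 2)) 0 0 P ⟨hred, hrest⟩
    (by intro x hx; rw [hfix x hx, hfix (x + 1) (by omega)]; omega)
    (by intro x hx; omega) (by intro x hx; omega) (by omega) (by omega)
  obtain ⟨k, bumps, Ps, e0, es, el⟩ := seq_of_reach P P' hreach
  exact ⟨wordProd P'.bot, k, bumps, Ps, hG, e0, es, by rw [el]; exact hC⟩

end BPDPaper
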